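/- Let G be a spider with body v, and let I and J be independent sets of G with |I| = |J| such that I ↭ J, no token of I is (G,I)-rigid, and no token of J is (G,J)-rigid. Suppose that I ∩ N(v) = ∅ and J ∩ N(v) = ∅, and that there exists a leg L of G with |I_L| ≠ |J_L|. Then there exists a TS-sequence between I and J of length exactly M*(G,I,J); in particular D*(G,I,J) = 0. -/

import Mathlib

/-!
Common definitions for formalizing "Shortest Reconfiguration Sequence for
Sliding Tokens on Spiders" (Hoang, Khorramian, Uehara).
-/

namespace SlidingTokenPaper

variable {V : Type*} [Fintype V] [DecidableEq V]

/-- A finite vertex set is independent in `G`. -/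
def IsIndep (G : SimpleGraph V) (I : Finset V) : Prop :=
  ∀ x ∈ I, ∀ y ∈ I, ¬ G.Adj x y

/-- One token slide: a token moves from `x` to `y` along an edge `xy`. -/
def Step (G : SimpleGraph V) (A B : Finset V) : Prop :=
  ∃ x y : V, G.Adj x y ∧ A \ B = {x} ∧ B \ A = {y}

/-- `S` is a TS-sequence between the independent sets `I` and `J` of `G`. -/
def IsTSSeq (G : SimpleGraph V) (I J : Finset V) (S : List (Finset V)) : Prop :=
  S ≠ [] ∧ S.head? = some I ∧ S.getLast? = some J ∧
  (∀ A ∈ S, IsIndep G A ∧ A.card = I.card) ∧ List.Chain' (Step G) S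

/-- The length of a TS-sequence: number of token slides. -/
def len (S : List (Finset V)) : ℕ := S.length - 1

/-- `I ↭ J`: there is a TS-sequence between `I` and `J`. -/
def Reconf (G : SimpleGraph V) (I J : Finset V) : Prop :=
  ∃ S, IsTSSeq G I J S

/-- `M*(G,I,J)`: the minimum over all bijections (target assignments)
`f : I → J` of `∑_{w ∈ I} dist_G(w, f(w))`. -/
noncomputable def Mstar (G : SimpleGraph V) (I J : Finset V) : ℕ :=
  sInf { m : ℕ | ∃ e : {x // x ∈ I} ≃ {y // y ∈ J},
    m = ∑ x : {x // x ∈ I}, G.dist (x : V) ((e x : V)) }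

/-- The number of occurrences of the move `x → y` in `S`. -/
def moveCount (S : List (Finset V)) (x y : V) : ℕ :=
  ((S.zip S.tail).filter fun p => p.1 \ p.2 = {x} ∧ p.2 \ p.1 = {y}).length

/-- `D_G(S, e)`: twice the minimum of the numbers of occurrences of the moves
`x → y` and `y → x` in `S`, where `e = xy`. -/
def detours (S : List (Finset V)) : Sym2 V → ℕ :=
  Sym2.lift ⟨fun x y => 2 * min (moveCount S x y) (moveCount S y x),
    fun x y => by dsimp only; rw [min_comm]⟩

open scoped Classical in
/-- `D_G(S)`: the total number of detours `S` makes, summed over the edges. -/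
noncomputable def totalDetours (G : SimpleGraph V) (S : List (Finset V)) : ℕ :=
  ∑ e ∈ Finset.univ.filter (· ∈ G.edgeSet), detours S e

/-- `D*(G,I,J)`: the minimum number of detours of a TS-sequence between `I` and `J`. -/
noncomputable def Dstar (G : SimpleGraph V) (I J : Finset V) : ℕ :=
  sInf { d : ℕ | ∃ S, IsTSSeq G I J S ∧ d = totalDetours G S }

/-- The token on `u ∈ I` is `(G, I)`-rigid: `u` belongs to every independent set
reachable from `I`. -/
def RigidToken (G : SimpleGraph V) (I : Finset V) (u : V) : Prop :=
  ∀ I', Reconf G I I' → u ∈ I'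

/-- `G` is a spider with body `v`: a tree with exactly one vertex of degree ≥ 3. -/
def IsSpider (G : SimpleGraph V) (v : V) : Prop :=
  G.IsTree ∧ 3 ≤ (G.neighborSet v).ncard ∧ ∀ w, 3 ≤ (G.neighborSet w).ncard → w = v

/-- For adjacent `x, y` in a tree `T`, `side T x y` is the vertex set of `T^x_y`,
the component of `T − xy` containing `y` (vertices strictly closer to `y` than to `x`). -/
def side (G : SimpleGraph V) (x y : V) : Set V :=
  {z | G.dist z y < G.dist z x}

/-- `|I ∩ V(L)|` for the leg `L` of the spider with body `v` containing the
neighbor `w` of `v`. -/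
noncomputable def legCard (G : SimpleGraph V) (I : Finset V) (v w : V) : ℕ :=
  ((I : Set V) ∩ side G v w).ncard

/-- `|I ∩ V(L)| − |J ∩ V(L)|` for the leg `L` of the spider indexed by the
neighbor `w` of the body `v`. -/
noncomputable def legDiff (G : SimpleGraph V) (I J : Finset V) (v w : V) : ℤ :=
  (legCard G I v w : ℤ) - (legCard G J v w : ℤ)

/-- The leg indexed by the neighbor `w₁` of `v` may serve as `L_1` in a labeling
of the legs making `|I∩V(L_i)| − |J∩V(L_i)|` nondecreasing, i.e. it minimizes the
difference. -/
def IsFirstLeg (G : SimpleGraph V) (I J : Finset V) (v w₁ : V) : Prop :=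
  G.Adj v w₁ ∧ ∀ w, G.Adj v w → legDiff G I J v w₁ ≤ legDiff G I J v w

/-- `I_L` for the leg `L` indexed by the neighbor `w` of the body `v`, where the
first leg (indexed by `w₁`) additionally receives `I ∩ {v}`. -/
noncomputable def ILeg (G : SimpleGraph V) (I : Finset V) (v w₁ w : V) : Set V :=
  ((I : Set V) ∩ side G v w) ∪ (if w = w₁ then (I : Set V) ∩ {v} else ∅)

/-- `|I_L|` for the leg `L` indexed by the neighbor `w` of the body `v`. -/
noncomputable def ILegCard (G : SimpleGraph V) (I : Finset V) (v w₁ w : V) : ℕ :=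
  (ILeg G I v w₁ w).ncard

/-- `S` makes a detour over the edge `ab`: both moves `a → b` and `b → a` occur in `S`. -/
def MakesDetour (S : List (Finset V)) (a b : V) : Prop :=
  0 < moveCount S a b ∧ 0 < moveCount S b a


set_option linter.unusedSectionVars false

/-- `par` sends every vertex of the spider `G` other than the body `v` to its neighbor towards `v`,
and `d` is the distance to `v`. -/
structure IsParentMap (G : SimpleGraph V) (v : V) (par : V → V) (d : V → ℕ) : Prop where
  par_root : par v = v
  depth_par : ∀ u, u ≠ v → d (par u) + 1 = d u
  adj_iff : ∀ x y, G.Adj x y ↔ (x ≠ v ∧ par x = y) ∨ (y ≠ v ∧ par y = x)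
  inj : ∀ x y, x ≠ v → y ≠ v → par x = par y → par x ≠ v → x = y

lemma eq_of_adj_of_dist_add_one {G : SimpleGraph V} (hG : G.IsTree) {v u x y : V}
    (hx : G.Adj x u) (hy : G.Adj y u) (hdx : G.dist v x + 1 = G.dist v u)
    (hdy : G.dist v y + 1 = G.dist v u) : x = y := by
  obtain ⟨p, hp⟩ := hG.connected.exists_walk_length_eq_dist v x
  obtain ⟨q, hq⟩ := hG.connected.exists_walk_length_eq_dist v y
  have hp' : (p.concat hx).IsPath := by
    apply SimpleGraph.Walk.isPath_of_length_eq_dist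
    simp [hp, hdx]
  have hq' : (q.concat hy).IsPath := by
    apply SimpleGraph.Walk.isPath_of_length_eq_dist
    simp [hq, hdy]
  have h := (hG.existsUnique_path v u).unique hp' hq'
  simpa using congrArg SimpleGraph.Walk.penultimate h

lemma IsSpider.exists_isParentMap {G : SimpleGraph V} {v : V} (hG : IsSpider G v) :
    ∃ par d, IsParentMap G v par d := by
  obtain ⟨hT, -, hdeg⟩ := hG
  have hex : ∀ u, ∃ x, (u = v → x = v) ∧ (u ≠ v → G.Adj x u ∧ G.dist v x + 1 = G.dist v u) := by
    intro u
    by_cases hu : u = v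
    · exact ⟨v, fun _ => rfl, fun h => (h hu).elim⟩
    · obtain ⟨p, hp⟩ := hT.connected.exists_walk_length_eq_dist u v
      cases p with
      | nil => exact (hu rfl).elim
      | @cons _ x _ h q =>
        refine ⟨x, fun h => (hu h).elim, fun _ => ⟨h.symm, ?_⟩⟩
        have h1 := SimpleGraph.dist_le q
        rw [SimpleGraph.Walk.length_cons] at hp
        have h2 := hT.dist_eq_dist_add_one_of_adj v h
        rw [SimpleGraph.dist_comm (u := x)] at h1
        rw [SimpleGraph.dist_comm (u := u)] at hp
        omega
  choose par hpar using hex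
  refine ⟨par, G.dist v, (hpar v).1 rfl, fun u hu => ((hpar u).2 hu).2, fun x y => ⟨fun h => ?_, ?_⟩,
    fun x y hx hy hxy hne => ?_⟩
  · rcases hT.dist_eq_dist_add_one_of_adj v h with h1 | h1
    · have hx : x ≠ v := by rintro rfl; simp at h1
      exact .inl ⟨hx, eq_of_adj_of_dist_add_one hT ((hpar x).2 hx).1 h.symm ((hpar x).2 hx).2 h1.symm⟩
    · have hy : y ≠ v := by rintro rfl; simp at h1
      exact .inr ⟨hy, eq_of_adj_of_dist_add_one hT ((hpar y).2 hy).1 h ((hpar y).2 hy).2 h1.symm⟩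
  · rintro (⟨h, rfl⟩ | ⟨h, rfl⟩)
    · exact ((hpar x).2 h).1.symm
    · exact ((hpar y).2 h).1
  · by_contra hne'
    obtain ⟨hxa, hxd⟩ := (hpar x).2 hx
    obtain ⟨hya, hyd⟩ := (hpar y).2 hy
    obtain ⟨hpa, hpd⟩ := (hpar (par x)).2 hne
    rw [← hxy] at hya hyd
    refine hne (hdeg (par x) ?_)
    have hsub : (({x, y, par (par x)} : Finset V) : Set V) ⊆ G.neighborSet (par x) := by
      intro z hz
      simp only [Finset.coe_insert, Finset.coe_singleton, Set.mem_insert_iff,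
        Set.mem_singleton_iff] at hz
      rcases hz with rfl | rfl | rfl
      · exact hxa
      · exact hya
      · exact hpa.symm
    have hcard : ({x, y, par (par x)} : Finset V).card = 3 := by
      rw [Finset.card_eq_three]
      refine ⟨_, _, _, hne', ?_, ?_, rfl⟩
      · intro h; rw [← h] at hpd; omega
      · intro h; rw [← h] at hpd; omega
    have := Set.ncard_le_ncard hsub (Set.toFinite _)
    rwa [Set.ncard_coe_finset, hcard] at this

open scoped Classical in
/-- The indicator of `z` being a descendant of `u`. -/
noncomputable def below (par : V → V) (u z : V) : ℤ := if ∃ n : ℕ, par^[n] z = u then 1 else 0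

/-- The surplus of tokens of `I` over tokens of `J` among the descendants of `u`. -/
noncomputable def excess (par : V → V) (I J : Finset V) (u : V) : ℤ :=
  ∑ z ∈ I, below par u z - ∑ z ∈ J, below par u z

/-- The number of tokens that must cross the edges of the tree, counted with multiplicity, when
`I` is transported to `J`. -/
noncomputable def potential (v : V) (par : V → V) (I J : Finset V) : ℕ :=
  ∑ u ∈ Finset.univ.erase v, (excess par I J u).natAbs

/-- No token is adjacent to the body. -/
def Clear (v : V) (par : V → V) (I : Finset V) : Prop := ∀ u ∈ I, u ≠ v → par u ≠ v

/-- `Slides G n A B`: the independent set `A` can be turned into `B` by `n` token slides. -/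
inductive Slides (G : SimpleGraph V) : ℕ → Finset V → Finset V → Prop
  | refl {A : Finset V} : IsIndep G A → Slides G 0 A A
  | cons {n : ℕ} {A B C : Finset V} :
      IsIndep G A → Step G A B → Slides G n B C → Slides G (n + 1) A C

/-- `A` after the token on `x` has moved to `y`. -/
def slide (A : Finset V) (x y : V) : Finset V := insert y (A.erase x)

lemma step_slide {G : SimpleGraph V} {A : Finset V} {x y : V} (h : G.Adj x y) (hx : x ∈ A)
    (hy : y ∉ A) : Step G A (slide A x y) := by
  have := h.ne
  refine ⟨x, y, h, ?_, ?_⟩ <;> ext z <;> simp only [slide, Finset.mem_sdiff, Finset.mem_insert,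
    Finset.mem_erase, Finset.mem_singleton] <;> grind

lemma Step.eq_slide {A B : Finset V} {x y : V} (h1 : A \ B = {x}) (h2 : B \ A = {y}) :
    x ∈ A ∧ y ∉ A ∧ B = slide A x y := by
  simp only [Finset.ext_iff, Finset.mem_sdiff, Finset.mem_singleton] at h1 h2
  refine ⟨((h1 x).2 rfl).1, ((h2 y).2 rfl).2, ?_⟩
  ext z
  simp only [slide, Finset.mem_insert, Finset.mem_erase]
  grind

lemma Step.symm {G : SimpleGraph V} {A B : Finset V} (h : Step G A B) : Step G B A := by
  obtain ⟨x, y, h, h1, h2⟩ := h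
  exact ⟨y, x, h.symm, h2, h1⟩

lemma Step.card_eq {G : SimpleGraph V} {A B : Finset V} (h : Step G A B) : B.card = A.card := by
  obtain ⟨x, y, h, h1, h2⟩ := h
  have h3 := Finset.card_sdiff_add_card_inter A B
  have h4 := Finset.card_sdiff_add_card_inter B A
  rw [Finset.inter_comm, h2] at h4
  rw [h1] at h3
  simp only [Finset.card_singleton] at h3 h4
  omega

lemma sum_slide {A : Finset V} {x y : V} (g : V → ℤ) (hx : x ∈ A) (hy : y ∉ A) :
    ∑ z ∈ slide A x y, g z = ∑ z ∈ A, g z - g x + g y := by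
  rw [slide, Finset.sum_insert (by simp [hy]), ← Finset.add_sum_erase A g hx]
  ring

lemma Slides.indep_left {G : SimpleGraph V} {n : ℕ} {A B : Finset V} (h : Slides G n A B) :
    IsIndep G A := by
  cases h <;> assumption

lemma Slides.trans {G : SimpleGraph V} {m n : ℕ} {A B C : Finset V} (h : Slides G m A B)
    (h' : Slides G n B C) : Slides G (m + n) A C := by
  induction h with
  | refl _ => simpa using h'
  | cons hA hs _ ih =>
    rw [Nat.add_right_comm]
    exact .cons hA hs (ih h')

lemma Slides.symm {G : SimpleGraph V} {n : ℕ} {A B : Finset V} (h : Slides G n A B) :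
    Slides G n B A := by
  induction h with
  | refl hA => exact .refl hA
  | cons hA hs h ih =>
    exact ih.trans (.cons h.indep_left hs.symm (.refl hA))

lemma Slides.card_eq {G : SimpleGraph V} {n : ℕ} {A B : Finset V} (h : Slides G n A B) :
    A.card = B.card := by
  induction h with
  | refl _ => rfl
  | cons _ hs _ ih => exact hs.card_eq.symm.trans ih

lemma Slides.exists_list {G : SimpleGraph V} {n : ℕ} {A B : Finset V} (h : Slides G n A B) :
    ∃ T, IsTSSeq G A B (A :: T) ∧ T.length = n := by
  induction h with
  | @refl A hA => exact ⟨[], ⟨by simp, rfl, rfl, by simpa using hA, List.isChain_singleton _⟩, rfl⟩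
  | @cons n A B C hA hs _ ih =>
    obtain ⟨T, ⟨-, -, h3, h4, h5⟩, h6⟩ := ih
    refine ⟨B :: T, ⟨by simp, rfl, by simpa using h3, ?_, List.isChain_cons_cons.2 ⟨hs, h5⟩⟩,
      by simp [h6]⟩
    intro D hD
    rcases List.mem_cons.1 hD with rfl | hD
    · exact ⟨hA, rfl⟩
    · exact ⟨(h4 D hD).1, (h4 D hD).2.trans hs.card_eq⟩

/-- Following the tokens along the slides gives a target assignment. -/
lemma Slides.exists_equiv {G : SimpleGraph V} (hG : G.Connected) {n : ℕ} {A B : Finset V}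
    (h : Slides G n A B) :
    ∃ e : {x // x ∈ A} ≃ {y // y ∈ B}, ∑ x : {x // x ∈ A}, G.dist (x : V) (e x : V) ≤ n := by
  induction h with
  | refl _ => exact ⟨Equiv.refl _, by simp⟩
  | @cons n A B C hA hs _ ih =>
    obtain ⟨e, he⟩ := ih
    obtain ⟨x, y, hxy, h1, h2⟩ := hs
    obtain ⟨hx, hy, rfl⟩ := Step.eq_slide h1 h2
    have hmem : ∀ z : V, z ∈ A ↔ Equiv.swap x y z ∈ slide A x y := by
      intro z
      have := hxy.ne
      simp only [slide, Finset.mem_insert, Finset.mem_erase, Equiv.swap_apply_def]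
      grind
    let f : {x // x ∈ A} ≃ {z // z ∈ slide A x y} := (Equiv.swap x y).subtypeEquiv hmem
    have hf : ∀ z : {z // z ∈ A}, G.dist (z : V) (f z : V) = if z = ⟨x, hx⟩ then 1 else 0 := by
      rintro ⟨z, hz⟩
      have hzy : z ≠ y := fun h => hy (h ▸ hz)
      by_cases hzx : z = x
      · subst hzx
        simp [f, SimpleGraph.dist_eq_one_iff_adj.2 hxy]
      · simp [f, hzx, Equiv.swap_apply_of_ne_of_ne hzx hzy]
    refine ⟨f.trans e, ?_⟩
    calc ∑ z : {z // z ∈ A}, G.dist (z : V) ((f.trans e) z : V)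
        ≤ ∑ z : {z // z ∈ A}, (G.dist (z : V) (f z : V) + G.dist (f z : V) (e (f z) : V)) :=
          Finset.sum_le_sum fun z _ => hG.dist_triangle
      _ = 1 + ∑ z : {z // z ∈ slide A x y}, G.dist (z : V) (e z : V) := by
          rw [Finset.sum_add_distrib, Finset.sum_congr rfl fun z _ => hf z,
            f.sum_comp fun z => G.dist (z : V) (e z : V)]
          simp
      _ ≤ n + 1 := by omega

lemma moveCount_cons_cons (A B : Finset V) (T : List (Finset V)) (x y : V) :
    moveCount (A :: B :: T) x y =
      (if A \ B = {x} ∧ B \ A = {y} then 1 else 0) + moveCount (B :: T) x y := by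
  unfold moveCount
  by_cases h : A \ B = {x} ∧ B \ A = {y} <;> simp [h, add_comm]

namespace IsParentMap

variable {G : SimpleGraph V} {v : V} {par : V → V} {d : V → ℕ}

lemma adj_par (h : IsParentMap G v par d) {x : V} (hx : x ≠ v) : G.Adj x (par x) :=
  (h.adj_iff _ _).2 (.inl ⟨hx, rfl⟩)

lemma ne_par (h : IsParentMap G v par d) {x : V} (hx : x ≠ v) : x ≠ par x :=
  (h.adj_par hx).ne

lemma depth_iterate_le (h : IsParentMap G v par d) (n : ℕ) (z : V) : d (par^[n] z) ≤ d z := by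
  induction n generalizing z with
  | zero => rfl
  | succ n ih =>
    rw [Function.iterate_succ_apply]
    refine (ih _).trans ?_
    by_cases hz : z = v
    · rw [hz, h.par_root]
    · have := h.depth_par z hz
      omega

lemma below_root (h : IsParentMap G v par d) (u : V) : below par u v = if u = v then 1 else 0 := by
  have : ∀ n : ℕ, par^[n] v = v := fun n => Function.iterate_fixed h.par_root n
  simp only [below, this, exists_const, eq_comm]

lemma below_eq_add (h : IsParentMap G v par d) {z : V} (hz : z ≠ v) (u : V) :
    below par u z = below par u (par z) + if u = z then 1 else 0 := by
  have hiff : (∃ n : ℕ, par^[n] z = u) ↔ z = u ∨ ∃ n : ℕ, par^[n] (par z) = u := by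
    constructor
    · rintro ⟨_ | n, hn⟩
      · exact .inl hn
      · exact .inr ⟨n, hn⟩
    · rintro (hn | ⟨n, hn⟩)
      · exact ⟨0, hn⟩
      · exact ⟨n + 1, hn⟩
  have hex : z = u → ¬ ∃ n : ℕ, par^[n] (par z) = u := by
    rintro rfl ⟨n, hn⟩
    have h1 := h.depth_iterate_le n (par z)
    have h2 := h.depth_par z hz
    rw [hn] at h1
    omega
  unfold below
  by_cases hzu : z = u
  · rw [if_pos (hiff.2 (.inl hzu)), if_neg (hex hzu), if_pos hzu.symm, zero_add]
  · rw [if_neg (Ne.symm hzu), add_zero]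
    classical exact if_congr (hiff.trans (or_iff_right hzu)) rfl rfl

/-- Every descendant of `u` is `u` itself or a descendant of exactly one child of `u`. -/
lemma below_eq_sum (h : IsParentMap G v par d) (u z : V) :
    below par u z = (if z = u then 1 else 0) +
      ∑ w ∈ (Finset.univ.erase v).filter (fun w => par w = u), below par w z := by
  induction hn : d z using Nat.strong_induction_on generalizing z with
  | _ n ih =>
  by_cases hz : z = v
  · subst hz
    rw [h.below_root, Finset.sum_eq_zero, add_zero]
    · exact if_congr eq_comm rfl rfl
    · intro w hw
      rw [h.below_root, if_neg]
      exact (Finset.mem_erase.1 (Finset.mem_filter.1 hw).1).1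
  · have hd := h.depth_par z hz
    rw [h.below_eq_add hz, ih _ (by omega) (par z) rfl,
      Finset.sum_congr rfl fun w _ => h.below_eq_add hz w, Finset.sum_add_distrib,
      Finset.sum_ite_eq']
    simp only [Finset.mem_filter, Finset.mem_erase, Finset.mem_univ, and_true, hz, ne_eq,
      not_false_eq_true, true_and, eq_comm (a := u)]
    ring

lemma excess_eq_sum (h : IsParentMap G v par d) (I J : Finset V) (u : V) :
    excess par I J u = (if u ∈ I then 1 else 0) - (if u ∈ J then 1 else 0) +
      ∑ w ∈ (Finset.univ.erase v).filter (fun w => par w = u), excess par I J w := by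
  unfold excess
  rw [Finset.sum_congr rfl fun z (_ : z ∈ I) => h.below_eq_sum u z,
    Finset.sum_congr rfl fun z (_ : z ∈ J) => h.below_eq_sum u z,
    Finset.sum_add_distrib, Finset.sum_add_distrib, Finset.sum_sub_distrib,
    Finset.sum_comm (s := I), Finset.sum_comm (s := J), Finset.sum_ite_eq', Finset.sum_ite_eq']
  ring

/-- A vertex other than the body has at most one child. -/
lemma excess_eq_of_child (h : IsParentMap G v par d) (I J : Finset V) {w : V} (hw : w ≠ v)
    (hpw : par w ≠ v) : excess par I J (par w) =
      (if par w ∈ I then 1 else 0) - (if par w ∈ J then 1 else 0) + excess par I J w := by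
  rw [h.excess_eq_sum I J (par w)]
  have : (Finset.univ.erase v).filter (fun x => par x = par w) = {w} := by
    ext x
    simp only [Finset.mem_filter, Finset.mem_erase, Finset.mem_univ, and_true,
      Finset.mem_singleton]
    refine ⟨fun hx => h.inj _ _ hx.1 hw hx.2 (hx.2 ▸ hpw), ?_⟩
    rintro rfl
    exact ⟨hw, rfl⟩
  rw [this, Finset.sum_singleton]

lemma exists_child_neg (h : IsParentMap G v par d) {I J : Finset V} {u : V}
    (hu : excess par I J u < (if u ∈ I then 1 else 0) - (if u ∈ J then 1 else 0)) :
    ∃ w, w ≠ v ∧ par w = u ∧ excess par I J w < 0 := by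
  by_contra! hc
  rw [h.excess_eq_sum] at hu
  have : 0 ≤ ∑ w ∈ (Finset.univ.erase v).filter (fun w => par w = u), excess par I J w :=
    Finset.sum_nonneg fun w hw => by
      simp only [Finset.mem_filter, Finset.mem_erase, Finset.mem_univ, and_true] at hw
      exact hc w hw.1 hw.2
  omega

lemma excess_root (h : IsParentMap G v par d) (I J : Finset V) :
    excess par I J v = I.card - J.card := by
  have hb : ∀ z, below par v z = 1 := by
    intro z
    induction hn : d z using Nat.strong_induction_on generalizing z with
    | _ n ih =>
    by_cases hz : z = v
    · rw [hz, h.below_root, if_pos rfl]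
    · have hd := h.depth_par z hz
      rw [h.below_eq_add hz, ih _ (by omega) _ rfl, if_neg (Ne.symm hz), add_zero]
  simp [excess, hb]

lemma excess_comm (I J : Finset V) (u : V) : excess par J I u = -excess par I J u := by
  simp [excess]

lemma potential_comm (I J : Finset V) : potential v par J I = potential v par I J := by
  unfold potential
  refine Finset.sum_congr rfl fun u _ => ?_
  rw [excess_comm, Int.natAbs_neg]

lemma excess_slide_up (h : IsParentMap G v par d) {I : Finset V} (J : Finset V) {x : V}
    (hv : x ≠ v) (hx : x ∈ I) (hy : par x ∉ I) (u : V) :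
    excess par (slide I x (par x)) J u = excess par I J u - if u = x then 1 else 0 := by
  rw [excess, sum_slide _ hx hy, h.below_eq_add hv, excess]
  ring

lemma excess_slide_down (h : IsParentMap G v par d) {I : Finset V} (J : Finset V) {y : V}
    (hv : y ≠ v) (hx : par y ∈ I) (hy : y ∉ I) (u : V) :
    excess par (slide I (par y) y) J u = excess par I J u + if u = y then 1 else 0 := by
  rw [excess, sum_slide _ hx hy, h.below_eq_add hv, excess]
  ring

lemma potential_slide_up (h : IsParentMap G v par d) {I J : Finset V} {x : V}
    (hv : x ≠ v) (hx : x ∈ I) (hy : par x ∉ I) (hc : 0 < excess par I J x) :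
    potential v par (slide I x (par x)) J + 1 = potential v par I J := by
  unfold potential
  have hm : x ∈ Finset.univ.erase v := by simp [hv]
  rw [← Finset.add_sum_erase _ _ hm, ← Finset.add_sum_erase _ _ hm,
    Finset.sum_congr rfl fun u hu => by
      rw [h.excess_slide_up J hv hx hy, if_neg (Finset.ne_of_mem_erase hu), sub_zero],
    h.excess_slide_up J hv hx hy, if_pos rfl]
  omega

lemma potential_slide_down (h : IsParentMap G v par d) {I J : Finset V} {y : V}
    (hv : y ≠ v) (hx : par y ∈ I) (hy : y ∉ I) (hc : excess par I J y < 0) :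
    potential v par (slide I (par y) y) J + 1 = potential v par I J := by
  unfold potential
  have hm : y ∈ Finset.univ.erase v := by simp [hv]
  rw [← Finset.add_sum_erase _ _ hm, ← Finset.add_sum_erase _ _ hm,
    Finset.sum_congr rfl fun u hu => by
      rw [h.excess_slide_down J hv hx hy, if_neg (Finset.ne_of_mem_erase hu), add_zero],
    h.excess_slide_down J hv hx hy, if_pos rfl]
  omega

lemma eq_of_potential_eq_zero (h : IsParentMap G v par d) {I J : Finset V}
    (hcard : I.card = J.card) (h0 : potential v par I J = 0) : I = J := by
  have hz : ∀ u, excess par I J u = 0 := by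
    intro u
    by_cases hu : u = v
    · rw [hu, h.excess_root, hcard, sub_self]
    · exact Int.natAbs_eq_zero.1 (Finset.sum_eq_zero_iff.1 h0 u (by simp [hu]))
  ext u
  have := h.excess_eq_sum I J u
  rw [hz, Finset.sum_eq_zero fun w _ => hz w] at this
  by_cases hI : u ∈ I <;> by_cases hJ : u ∈ J <;> simp [hI, hJ] at this ⊢

lemma potential_le_sum_dist (h : IsParentMap G v par d) (hG : G.Connected) {I J : Finset V}
    (e : {x // x ∈ I} ≃ {y // y ∈ J}) :
    potential v par I J ≤ ∑ x : {x // x ∈ I}, G.dist (x : V) (e x : V) := by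
  have hwalk : ∀ {x y : V} (p : G.Walk x y),
      ∑ u ∈ Finset.univ.erase v, (below par u x - below par u y).natAbs ≤ p.length := by
    intro x y p
    induction p with
    | nil => simp
    | @cons x z y hxz p ih =>
      have h1 : ∑ u ∈ Finset.univ.erase v, (below par u x - below par u z).natAbs ≤ 1 := by
        rcases (h.adj_iff _ _).1 hxz with ⟨hv, rfl⟩ | ⟨hv, rfl⟩
        · rw [Finset.sum_congr rfl fun u _ => by rw [h.below_eq_add hv, add_sub_cancel_left],
            Finset.sum_eq_single x (fun u _ hu => by simp [hu]) (fun _ => by simp_all)]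
          simp
        · rw [Finset.sum_congr rfl fun u _ => by
              rw [h.below_eq_add hv, sub_add_cancel_left, Int.natAbs_neg],
            Finset.sum_eq_single z (fun u _ hu => by simp [hu]) (fun _ => by simp_all)]
          simp
      calc _ ≤ ∑ u ∈ Finset.univ.erase v, ((below par u x - below par u z).natAbs +
              (below par u z - below par u y).natAbs) := Finset.sum_le_sum fun u _ => by omega
        _ ≤ 1 + p.length := by
          rw [Finset.sum_add_distrib]
          exact add_le_add h1 ih
        _ = _ := by rw [SimpleGraph.Walk.length_cons, add_comm]
  have hdist : ∀ x y : V,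
      ∑ u ∈ Finset.univ.erase v, (below par u x - below par u y).natAbs ≤ G.dist x y := by
    intro x y
    obtain ⟨p, hp⟩ := hG.exists_walk_length_eq_dist x y
    exact hp ▸ hwalk p
  calc potential v par I J
      ≤ ∑ u ∈ Finset.univ.erase v, ∑ x : {x // x ∈ I},
          (below par u (x : V) - below par u (e x : V)).natAbs := by
        refine Finset.sum_le_sum fun u _ => ?_
        have : excess par I J u =
            ∑ x : {x // x ∈ I}, (below par u (x : V) - below par u (e x : V)) := by
          rw [Finset.sum_sub_distrib, e.sum_comp fun y => below par u (y : V), excess,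
            Finset.sum_coe_sort I (below par u), Finset.sum_coe_sort J (below par u)]
        rw [this]
        exact Int.natAbs_sum_le _ _
    _ ≤ _ := by
        rw [Finset.sum_comm]
        exact Finset.sum_le_sum fun x _ => hdist _ _

lemma potential_eq_Mstar (h : IsParentMap G v par d) (hG : G.Connected) {I J : Finset V}
    (hs : Slides G (potential v par I J) I J) : potential v par I J = Mstar G I J := by
  obtain ⟨e, he⟩ := hs.exists_equiv hG
  have hle : Mstar G I J ≤ _ := Nat.sInf_le ⟨e, rfl⟩
  refine le_antisymm (le_csInf ⟨_, e, rfl⟩ ?_) (hle.trans he)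
  rintro _ ⟨e', rfl⟩
  exact h.potential_le_sum_dist hG e'

/-- The net number of moves over an edge is the excess below it, and every move crosses exactly
one edge. -/
lemma moveCount_of_isChain (h : IsParentMap G v par d) {J : Finset V} (T : List (Finset V)) :
    ∀ A : Finset V, List.IsChain (Step G) (A :: T) → (A :: T).getLast? = some J →
      (∀ u, u ≠ v → excess par A J u =
        moveCount (A :: T) u (par u) - moveCount (A :: T) (par u) u) ∧
      ∑ u ∈ Finset.univ.erase v, (moveCount (A :: T) u (par u) + moveCount (A :: T) (par u) u) =
        T.length := by
  induction T with
  | nil =>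
    intro A _ hl
    obtain rfl : A = J := by simpa using hl
    simp [excess, moveCount]
  | cons B T ih =>
    intro A hc hl
    obtain ⟨hs, hc⟩ := List.isChain_cons_cons.1 hc
    obtain ⟨ih1, ih2⟩ := ih B hc (by simpa using hl)
    obtain ⟨x, y, hxy, h1, h2⟩ := hs
    obtain ⟨hx, hy, hB⟩ := Step.eq_slide h1 h2
    have key : ∃ w, w ≠ v ∧ ((∀ u, u ≠ v →
        excess par A J u = excess par B J u + (if u = w then 1 else 0) ∧
        (if A \ B = {u} ∧ B \ A = {par u} then 1 else 0) = (if u = w then 1 else 0) ∧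
        (if A \ B = {par u} ∧ B \ A = {u} then 1 else 0) = 0) ∨ (∀ u, u ≠ v →
        excess par A J u = excess par B J u - (if u = w then 1 else 0) ∧
        (if A \ B = {u} ∧ B \ A = {par u} then 1 else 0) = 0 ∧
        (if A \ B = {par u} ∧ B \ A = {u} then 1 else 0) = (if u = w then 1 else 0))) := by
      simp only [h1, h2, Finset.singleton_inj]
      rcases (h.adj_iff _ _).1 hxy with ⟨hv, rfl⟩ | ⟨hv, rfl⟩
      · refine ⟨x, hv, .inl fun u hu => ⟨?_, ?_, ?_⟩⟩
        · rw [hB, h.excess_slide_up J hv hx hy, sub_add_cancel]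
        · grind
        · have := h.depth_par x hv
          have := h.depth_par u hu
          rw [if_neg]
          rintro ⟨h3, h4⟩
          have := congrArg d h3
          have := congrArg d h4
          omega
      · refine ⟨y, hv, .inr fun u hu => ⟨?_, ?_, ?_⟩⟩
        · rw [hB, h.excess_slide_down J hv hx hy, add_sub_cancel_right]
        · have := h.depth_par y hv
          have := h.depth_par u hu
          rw [if_neg]
          rintro ⟨h3, h4⟩
          have := congrArg d h3
          have := congrArg d h4
          omega
        · grind
    obtain ⟨w, hw, key⟩ := key
    have hsum : ∑ u ∈ Finset.univ.erase v, (if u = w then 1 else 0) = 1 := by simp [hw]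
    simp only [moveCount_cons_cons]
    refine ⟨fun u hu => ?_, ?_⟩
    · have := ih1 u hu
      rcases key with key | key
      all_goals
        obtain ⟨k1, k2, k3⟩ := key u hu
        rw [k1, k2, k3, this]
        push_cast
        ring
    · have : ∀ u ∈ Finset.univ.erase v,
          (((if A \ B = {u} ∧ B \ A = {par u} then 1 else 0) + moveCount (B :: T) u (par u)) +
          ((if A \ B = {par u} ∧ B \ A = {u} then 1 else 0) + moveCount (B :: T) (par u) u)) =
          (if u = w then 1 else 0) +
            (moveCount (B :: T) u (par u) + moveCount (B :: T) (par u) u) := by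
        intro u hu
        rcases key with key | key
        all_goals
          obtain ⟨-, k2, k3⟩ := key u (Finset.ne_of_mem_erase hu)
          rw [k2, k3]
          omega
      rw [Finset.sum_congr rfl this, Finset.sum_add_distrib, hsum, ih2, List.length_cons, add_comm]

lemma totalDetours_eq_zero (h : IsParentMap G v par d) {I J : Finset V} {T : List (Finset V)}
    (hS : IsTSSeq G I J (I :: T)) (hlen : T.length = potential v par I J) :
    totalDetours G (I :: T) = 0 := by
  obtain ⟨-, -, hl, -, hc⟩ := hS
  obtain ⟨h1, h2⟩ := h.moveCount_of_isChain T I hc hl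
  have hmin : ∀ u, u ≠ v →
      min (moveCount (I :: T) u (par u)) (moveCount (I :: T) (par u) u) = 0 := by
    have hle : ∀ u ∈ Finset.univ.erase v, (excess par I J u).natAbs ≤
        moveCount (I :: T) u (par u) + moveCount (I :: T) (par u) u := by
      intro u hu
      have := h1 u (Finset.ne_of_mem_erase hu)
      omega
    intro u hu
    have := (Finset.sum_eq_sum_iff_of_le hle).1 (h2.trans hlen).symm u (by simp [hu])
    have := h1 u hu
    omega
  unfold totalDetours
  refine Finset.sum_eq_zero fun e he => ?_
  induction e with
  | _ x y =>
  have hxy : G.Adj x y := by simpa using he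
  rcases (h.adj_iff _ _).1 hxy with ⟨hv, rfl⟩ | ⟨hv, rfl⟩
  · simp only [detours, Sym2.lift_mk, hmin x hv, mul_zero]
  · simp only [detours, Sym2.lift_mk, min_comm (moveCount (I :: T) (par y) y), hmin y hv, mul_zero]

end IsParentMap

/-- `I` can be slid to another independent set without tokens next to the body, with every slide
bringing it closer to `J`. -/
def Progress (G : SimpleGraph V) (v : V) (par : V → V) (I J : Finset V) : Prop :=
  ∃ I' k, 0 < k ∧ Clear v par I' ∧ Slides G k I I' ∧ potential v par I' J + k = potential v par I J

namespace IsParentMap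

variable {G : SimpleGraph V} {v : V} {par : V → V} {d : V → ℕ}

lemma indep_slide (h : IsParentMap G v par d) {I : Finset V} {x y : V} (hI : IsIndep G I)
    (hup : y ≠ v → par y ∈ I → par y = x) (hdown : ∀ z ∈ I, z ≠ v → par z = y → z = x) :
    IsIndep G (slide I x y) := by
  have key : ∀ z ∈ I.erase x, ¬ G.Adj z y := by
    intro z hz hadj
    obtain ⟨hzx, hz⟩ := Finset.mem_erase.1 hz
    rcases (h.adj_iff _ _).1 hadj with ⟨hv, h1⟩ | ⟨hv, rfl⟩
    · exact hzx (hdown z hz hv h1)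
    · exact hzx (hup hv hz)
  intro a ha b hb
  rcases Finset.mem_insert.1 ha with rfl | ha' <;> rcases Finset.mem_insert.1 hb with rfl | hb'
  · exact G.irrefl
  · exact fun hadj => key b hb' hadj.symm
  · exact key a ha'
  · exact hI a (Finset.mem_of_mem_erase ha') b (Finset.mem_of_mem_erase hb')

lemma clear_slide {I : Finset V} {x y : V} (hC : Clear v par I) (hy : y = v ∨ par y ≠ v) :
    Clear v par (slide I x y) := by
  intro z hz hzv
  rcases Finset.mem_insert.1 hz with rfl | hz
  · exact hy.resolve_left hzv
  · exact hC z (Finset.mem_of_mem_erase hz) hzv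

lemma par_notMem (h : IsParentMap G v par d) {I : Finset V} (hI : IsIndep G I) {x : V}
    (hx : x ∈ I) (hv : x ≠ v) : par x ∉ I :=
  fun hp => hI _ hx _ hp (h.adj_par hv)

/-- Among the tokens on a leg that have to move down, the deepest one is free to do so. -/
lemma progress_down (h : IsParentMap G v par d) {I J : Finset V} (hI : IsIndep G I)
    (hJ : IsIndep G J) (hC : Clear v par I)
    (hex : ∃ y, y ≠ v ∧ par y ≠ v ∧ par y ∈ I ∧ excess par I J y < 0) :
    Progress G v par I J := by
  classical
  obtain ⟨y, hy, hmax⟩ := Finset.exists_max_image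
    (Finset.univ.filter fun y => y ≠ v ∧ par y ≠ v ∧ par y ∈ I ∧ excess par I J y < 0) d
    (by obtain ⟨y, hy⟩ := hex; exact ⟨y, by simpa using hy⟩)
  simp only [Finset.mem_filter, Finset.mem_univ, true_and] at hy hmax
  obtain ⟨hyv, hpv, hpI, hc⟩ := hy
  have hyI : y ∉ I := fun hyI => h.par_notMem hI hyI hyv hpI
  have hch : ∀ z ∈ I, z ≠ v → par z ≠ y := by
    rintro z hz hzv rfl
    have h1 := h.excess_eq_of_child I J hzv hyv
    have hzJ : par z ∈ J → z ∉ J := fun hp hzJ => h.par_notMem hJ hzJ hzv hp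
    obtain ⟨w, hwv, rfl, hw⟩ := h.exists_child_neg (I := I) (J := J) (u := z) (by
      rw [if_neg hyI] at h1
      rw [if_pos hz]
      by_cases hp : par z ∈ J
      · rw [if_pos hp] at h1
        rw [if_neg (hzJ hp)]
        omega
      · rw [if_neg hp] at h1
        split_ifs <;> omega)
    have := hmax w ⟨hwv, hzv, hz, hw⟩
    have := h.depth_par w hwv
    have := h.depth_par (par w) hzv
    omega
  refine ⟨slide I (par y) y, 1, one_pos, clear_slide hC (.inr hpv),
    .cons hI (step_slide (h.adj_par hyv).symm hpI hyI) (.refl ?_),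
    h.potential_slide_down hyv hpI hyI hc⟩
  exact h.indep_slide hI (fun _ _ => rfl) fun z hz hzv hzy => (hch z hz hzv hzy).elim

/-- Among the tokens on a leg that have to move up, the topmost one is free to do so unless it is
at distance two from the body. -/
lemma progress_up (h : IsParentMap G v par d) {I J : Finset V} (hI : IsIndep G I)
    (hJ : IsIndep G J) (hC : Clear v par I)
    (hex : ∃ u, u ≠ v ∧ 0 < excess par I J u) :
    Progress G v par I J ∨
      ∃ p ∈ I, p ≠ v ∧ par p ≠ v ∧ par (par p) = v ∧ 0 < excess par I J p := by
  classical
  have htok : ∃ u, u ∈ I ∧ u ≠ v ∧ 0 < excess par I J u := by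
    obtain ⟨u, hu, hmax⟩ := Finset.exists_max_image
      (Finset.univ.filter fun u => u ≠ v ∧ 0 < excess par I J u) d
      (by obtain ⟨u, hu⟩ := hex; exact ⟨u, by simpa using hu⟩)
    simp only [Finset.mem_filter, Finset.mem_univ, true_and] at hu hmax
    refine ⟨u, ?_, hu⟩
    by_contra huI
    have h1 := h.excess_eq_sum I J u
    have h2 : ∑ w ∈ (Finset.univ.erase v).filter (fun w => par w = u), excess par I J w ≤ 0 := by
      refine Finset.sum_nonpos fun w hw => ?_
      simp only [Finset.mem_filter, Finset.mem_erase, Finset.mem_univ, and_true] at hw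
      obtain ⟨hwv, rfl⟩ := hw
      by_contra! hlt
      have := hmax w ⟨hwv, hlt⟩
      have := h.depth_par w hwv
      omega
    rw [if_neg huI] at h1
    split_ifs at h1 <;> omega
  obtain ⟨u, hu, hmin⟩ := Finset.exists_min_image
    (Finset.univ.filter fun u => u ∈ I ∧ u ≠ v ∧ 0 < excess par I J u) d
    (by obtain ⟨u, hu⟩ := htok; exact ⟨u, by simpa using hu⟩)
  simp only [Finset.mem_filter, Finset.mem_univ, true_and] at hu hmin
  obtain ⟨huI, huv, hc⟩ := hu
  have hpv : par u ≠ v := hC u huI huv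
  have hpI := h.par_notMem hI huI huv
  by_cases hr : par (par u) = v
  · exact .inr ⟨u, huI, huv, hpv, hr, hc⟩
  · have hrI : par (par u) ∉ I := by
      intro hrI
      have h1 := h.excess_eq_of_child I J huv hpv
      have h2 := h.excess_eq_of_child I J hpv hr
      have h3 : par u ∈ J → par (par u) ∉ J := fun hp => h.par_notMem hJ hp hpv
      rw [if_neg hpI] at h1
      rw [if_pos hrI] at h2
      have := hmin _ ⟨hrI, hr, by
        by_cases hp : par u ∈ J
        · rw [if_pos hp] at h1
          rw [if_neg (h3 hp)] at h2
          omega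
        · rw [if_neg hp] at h1
          split_ifs at h2 <;> omega⟩
      have := h.depth_par u huv
      have := h.depth_par _ hpv
      omega
    refine .inl ⟨slide I u (par u), 1, one_pos, clear_slide hC (.inr hr),
      .cons hI (step_slide (h.adj_par huv) huI hpI) (.refl ?_),
      h.potential_slide_up huv huI hpI hc⟩
    exact h.indep_slide hI (fun _ hm => (hrI hm).elim)
      fun z _ hzv hzu => h.inj _ _ hzv huv hzu (hzu ▸ hpv)

/-- A token at distance two from the body can move onto the free body. -/
lemma progress_to_body (h : IsParentMap G v par d) {I J : Finset V} (hI : IsIndep G I)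
    (hCI : Clear v par I) (hCJ : Clear v par J) (hv : v ∉ I) {p : V} (hp : p ∈ I)
    (hpv : p ≠ v) (hqv : par p ≠ v) (hq : par (par p) = v) (hc : 0 < excess par I J p) :
    Progress G v par I J := by
  have hqI : par p ∉ I := h.par_notMem hI hp hpv
  have hqJ : par p ∉ J := fun hm => hCJ _ hm hqv hq
  have hcq : excess par I J (par p) = excess par I J p := by
    rw [h.excess_eq_of_child I J hpv hqv, if_neg hqI, if_neg hqJ]
    ring
  have hne := h.ne_par hpv
  have hq1 : par p ∈ slide I p (par p) := Finset.mem_insert_self _ _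
  have hv1 : par (par p) ∉ slide I p (par p) := by
    rw [hq]
    simp [slide, hv, Ne.symm hqv]
  have hI1 : IsIndep G (slide I p (par p)) := h.indep_slide hI
    (fun _ hm => (hv (hq ▸ hm)).elim) fun z _ hzv hzp => h.inj _ _ hzv hpv hzp (hzp ▸ hqv)
  have hp1 := h.potential_slide_up hpv hp hqI hc
  have hp2 := h.potential_slide_up (J := J) hqv hq1 hv1 (by
    rw [h.excess_slide_up J hpv hp hqI, if_neg hne.symm, hcq]
    omega)
  have hstep := step_slide (h.adj_par hqv) hq1 hv1
  rw [hq] at hp2 hstep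
  refine ⟨slide (slide I p (par p)) (par p) v, 2, two_pos, ?_, .cons hI
    (step_slide (h.adj_par hpv) hp hqI) (.cons hI1 hstep (.refl ?_)), by omega⟩
  · intro z hz hzv
    simp only [slide, Finset.mem_insert, Finset.mem_erase] at hz
    exact hCI z (by tauto) hzv
  · refine h.indep_slide hI1 (fun hvv => (hvv rfl).elim) fun z hz hzv hzp => ?_
    simp only [slide, Finset.mem_insert, Finset.mem_erase] at hz
    by_contra hzq
    exact hCI z (by tauto) hzv hzp

/-- The token on the body can move to a vertex at distance two from the body if that vertex and
its child are free. -/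
lemma progress_from_body (h : IsParentMap G v par d) {I J : Finset V} (hI : IsIndep G I)
    (hCI : Clear v par I) (hCJ : Clear v par J) (hv : v ∈ I) {p : V} (hp : p ∉ I)
    (hch : ∀ z ∈ I, z ≠ v → par z ≠ p) (hpv : p ≠ v) (hqv : par p ≠ v) (hq : par (par p) = v)
    (hc : excess par I J p < 0) : Progress G v par I J := by
  have hqI : par p ∉ I := fun hm => hCI _ hm hqv hq
  have hqJ : par p ∉ J := fun hm => hCJ _ hm hqv hq
  have hcq : excess par I J (par p) = excess par I J p := by
    rw [h.excess_eq_of_child I J hpv hqv, if_neg hqI, if_neg hqJ]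
    ring
  have hne := h.ne_par hpv
  have hvq : par (par p) ∈ I := hq.symm ▸ hv
  have hI1 : IsIndep G (slide I (par (par p)) (par p)) := h.indep_slide hI (fun _ _ => rfl)
    fun z hz hzv hzp => (hp (h.inj _ _ hzv hpv hzp (hzp ▸ hqv) ▸ hz)).elim
  have hq1 : par p ∈ slide I (par (par p)) (par p) := Finset.mem_insert_self _ _
  have hp1 : p ∉ slide I (par (par p)) (par p) := by simp [slide, hp, hne]
  have hpot1 := h.potential_slide_down hqv hvq hqI (hcq ▸ hc)
  have hpot2 := h.potential_slide_down (J := J) hpv hq1 hp1 (by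
    rw [h.excess_slide_down J hqv hvq hqI, if_neg hne]
    omega)
  refine ⟨slide (slide I (par (par p)) (par p)) (par p) p, 2, two_pos, ?_, .cons hI
    (step_slide (h.adj_par hqv).symm hvq hqI) (.cons hI1
      (step_slide (h.adj_par hpv).symm hq1 hp1) (.refl ?_)), by omega⟩
  · intro z hz hzv
    simp only [slide, Finset.mem_insert, Finset.mem_erase] at hz
    by_cases hzp : z = p
    · exact hzp ▸ hqv
    · exact hCI z (by tauto) hzv
  · refine h.indep_slide hI1 (fun _ _ => rfl) fun z hz hzv hzp => ?_
    simp only [slide, Finset.mem_insert, Finset.mem_erase] at hz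
    by_contra hzq
    exact hch z (by tauto) hzv hzp

lemma progress_of_pos (h : IsParentMap G v par d) {I J : Finset V} (hI : IsIndep G I)
    (hJ : IsIndep G J) (hcard : I.card = J.card) (hCI : Clear v par I) (hCJ : Clear v par J)
    (hex : ∃ u, u ≠ v ∧ 0 < excess par I J u) :
    Progress G v par I J ∨ Progress G v par J I := by
  rcases h.progress_up hI hJ hCI hex with hP | ⟨p, hp, hpv, hqv, hq, hc⟩
  · exact .inl hP
  by_cases hv : v ∈ I
  swap
  · exact .inl (h.progress_to_body hI hCI hCJ hv hp hpv hqv hq hc)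
  have hcq : 0 < excess par I J (par p) := by
    rw [h.excess_eq_of_child I J hpv hqv, if_neg (h.par_notMem hI hp hpv),
      if_neg fun hm => hCJ _ hm hqv hq]
    omega
  have hsink : ∃ u, u ≠ v ∧ 0 < excess par J I u := by
    by_contra! hns
    have h1 := h.excess_eq_sum I J v
    have h2 : 0 < ∑ w ∈ (Finset.univ.erase v).filter (fun w => par w = v), excess par I J w := by
      refine Finset.sum_pos' (fun w hw => ?_) ⟨par p, by simp [hqv, hq], hcq⟩
      simp only [Finset.mem_filter, Finset.mem_erase, Finset.mem_univ, and_true] at hw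
      have := hns w hw.1
      rw [excess_comm] at this
      omega
    rw [h.excess_root, hcard, if_pos hv] at h1
    split_ifs at h1 <;> omega
  rcases h.progress_up hJ hI hCJ hsink with hP | ⟨p', hp', hpv', hqv', hq', hc'⟩
  · exact .inr hP
  by_cases hvJ : v ∈ J
  swap
  · exact .inr (h.progress_to_body hJ hCJ hCI hvJ hp' hpv' hqv' hq' hc')
  rw [excess_comm] at hc'
  by_cases hpI : p' ∈ I
  · obtain ⟨y, hyv, rfl, hy⟩ := h.exists_child_neg (I := I) (J := J) (u := p') (by
      rw [if_pos hpI, if_pos hp']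
      omega)
    exact .inl (h.progress_down hI hJ hCI ⟨y, hyv, hpv', hpI, hy⟩)
  by_cases hch : ∀ z ∈ I, z ≠ v → par z ≠ p'
  · exact .inl (h.progress_from_body hI hCI hCJ hv hpI hch hpv' hqv' hq' (by omega))
  push Not at hch
  obtain ⟨z, hz, hzv, rfl⟩ := hch
  have h1 := h.excess_eq_of_child I J hzv hpv'
  rw [if_neg hpI, if_pos hp'] at h1
  obtain ⟨y, hyv, rfl, hy⟩ := h.exists_child_neg (I := I) (J := J) (u := z) (by
    rw [if_pos hz, if_neg fun hm => h.par_notMem hJ hm hzv hp']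
    omega)
  exact .inl (h.progress_down hI hJ hCI ⟨y, hyv, hzv, hz, hy⟩)

lemma progress_of_ne (h : IsParentMap G v par d) {I J : Finset V} (hI : IsIndep G I)
    (hJ : IsIndep G J) (hcard : I.card = J.card) (hCI : Clear v par I) (hCJ : Clear v par J)
    (hne : potential v par I J ≠ 0) : Progress G v par I J ∨ Progress G v par J I := by
  obtain ⟨u, hu, hcu⟩ := Finset.exists_ne_zero_of_sum_ne_zero hne
  have huv := Finset.ne_of_mem_erase hu
  rcases lt_or_gt_of_ne (Int.natAbs_ne_zero.1 hcu) with hlt | hgt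
  · refine (h.progress_of_pos hJ hI hcard.symm hCJ hCI ⟨u, huv, ?_⟩).symm
    rw [excess_comm]
    omega
  · exact h.progress_of_pos hI hJ hcard hCI hCJ ⟨u, huv, hgt⟩

lemma slides_potential (h : IsParentMap G v par d) {I J : Finset V} (hI : IsIndep G I)
    (hJ : IsIndep G J) (hcard : I.card = J.card) (hCI : Clear v par I) (hCJ : Clear v par J) :
    Slides G (potential v par I J) I J := by
  induction hn : potential v par I J using Nat.strong_induction_on generalizing I J with
  | _ n ih =>
  by_cases h0 : potential v par I J = 0
  · obtain rfl := h.eq_of_potential_eq_zero hcard h0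
    rw [← hn, h0]
    exact .refl hI
  · rcases h.progress_of_ne hI hJ hcard hCI hCJ h0 with
      ⟨A, k, hk, hCA, hs, hp⟩ | ⟨A, k, hk, hCA, hs, hp⟩
    · have := ih _ (by omega) hs.symm.indep_left hJ (hs.card_eq.symm.trans hcard) hCA hCJ rfl
      obtain rfl : n = k + potential v par A J := by omega
      exact hs.trans this
    · rw [potential_comm I J, potential_comm I A] at hp
      have := ih _ (by omega) hI hs.symm.indep_left (hcard.trans hs.card_eq) hCI hCA rfl
      obtain rfl : n = potential v par I A + k := by omega
      exact this.trans hs.symm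

end IsParentMap

/-- Lemma 4 of the paper. If no token of `I` or `J` is adjacent
to the body `v` and some leg `L` has `|I_L| ≠ |J_L|`, then there is a TS-sequence
between `I` and `J` of length exactly `M*(G,I,J)`; in particular `D*(G,I,J) = 0`. -/
theorem spider_no_tokens_near_body_no_detours
    {V : Type*} [Fintype V] [DecidableEq V] (G : SimpleGraph V) (v : V)
    (hG : IsSpider G v) (I J : Finset V)
    (hI : IsIndep G I) (hJ : IsIndep G J) (hcard : I.card = J.card)
    (hreconf : Reconf G I J)
    (hIrigid : ∀ u ∈ I, ¬ RigidToken G I u)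
    (hJrigid : ∀ u ∈ J, ¬ RigidToken G J u)
    (hIN : (I : Set V) ∩ G.neighborSet v = ∅)
    (hJN : (J : Set V) ∩ G.neighborSet v = ∅)
    (w₁ : V) (hw₁ : IsFirstLeg G I J v w₁)
    (hleg : ∃ w, G.Adj v w ∧ ILegCard G I v w₁ w ≠ ILegCard G J v w₁ w) :
    (∃ S, IsTSSeq G I J S ∧ len S = Mstar G I J) ∧ Dstar G I J = 0 := by
  obtain ⟨par, d, h⟩ := hG.exists_isParentMap
  have hclear : ∀ A : Finset V, (A : Set V) ∩ G.neighborSet v = ∅ → Clear v par A := by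
    intro A hA u hu huv hpu
    have : u ∈ (A : Set V) ∩ G.neighborSet v := ⟨hu, hpu ▸ (h.adj_par huv).symm⟩
    simp [hA] at this
  have hs := h.slides_potential hI hJ hcard (hclear I hIN) (hclear J hJN)
  obtain ⟨T, hT, hlen⟩ := hs.exists_list
  refine ⟨⟨I :: T, hT, hlen.trans (h.potential_eq_Mstar hG.1.connected hs)⟩, ?_⟩
  exact Nat.le_zero.1 (Nat.sInf_le ⟨I :: T, hT, (h.totalDetours_eq_zero hT hlen).symm⟩)

end SlidingTokenPaper
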